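/- arXiv:1106.0456 — 2 statements merged into one kernel-verified Lean document; each statement's English description precedes it below -/
import Mathlib

section
/- Let b ∈ BMO(ℝⁿ). The commutator [b,ℋ] maps H¹(ℝⁿ) to weak L¹(ℝⁿ): there exists C (depending only on n) such that for every f ∈ H¹(ℝⁿ) and λ > 0, λ·|{x : |[b,ℋ]f(x)| > λ}| ≤ C‖b‖_{BMO}‖f‖_{H¹}. -/
open MeasureTheory Metric

/-- Volume of the ball of radius `r` in `ℝⁿ`. -/
noncomputable def ballVol (n : ℕ) (r : ℝ) : ℝ :=
  (volume (ball (0 : EuclideanSpace ℝ (Fin n)) r)).toReal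

/-- The `n`-dimensional Hardy operator
`ℋf(x) = (1/(vₙ |x|ⁿ)) ∫_{|y| < |x|} f(y) dy`. -/
noncomputable def hardyOp (n : ℕ) (f : EuclideanSpace ℝ (Fin n) → ℝ)
    (x : EuclideanSpace ℝ (Fin n)) : ℝ :=
  (ballVol n 1 * ‖x‖ ^ n)⁻¹ * ∫ y in ball (0 : EuclideanSpace ℝ (Fin n)) ‖x‖, f y

/-- A `(1,∞,0)`-atom: supported in `B(x₀,r)`, bounded by `|B(x₀,r)|⁻¹`,
with vanishing integral. -/
def IsAtomInfZero (n : ℕ) (x₀ : EuclideanSpace ℝ (Fin n)) (r : ℝ)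
    (a : EuclideanSpace ℝ (Fin n) → ℝ) : Prop :=
  Measurable a ∧ (∀ x, x ∉ ball x₀ r → a x = 0) ∧
    (∀ x, |a x| ≤ ((volume (ball x₀ r)).toReal)⁻¹) ∧ (∫ x, a x) = 0

section HardyCommutator

variable {n : ℕ}

local notation "E" n => EuclideanSpace ℝ (Fin n)

lemma ballVol_one_pos (n : ℕ) : 0 < ballVol n 1 :=
  ENNReal.toReal_pos (measure_ball_pos _ _ one_pos).ne' measure_ball_lt_top.ne

lemma toReal_volume_ball (x : E n) {r : ℝ} (hr : 0 < r) :
    (volume (ball x r)).toReal = ballVol n 1 * r ^ n := by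
  rw [Measure.addHaar_ball_of_pos volume x hr, ENNReal.toReal_mul,
    ENNReal.toReal_ofReal (by positivity), finrank_euclideanSpace_fin, ballVol, mul_comm]

lemma MeasureTheory.LocallyIntegrable.integrableOn_ball {b : (E n) → ℝ}
    (hb : LocallyIntegrable b volume) (x : E n) (r : ℝ) : IntegrableOn b (ball x r) :=
  (hb.integrableOn_isCompact (isCompact_closedBall x r)).mono_set ball_subset_closedBall

/-- On every ball `ball c ρ`, the function `b` deviates from the constant `m c ρ` by at most `M` in
mean. -/
def MeanOscLE (b : (E n) → ℝ) (m : (E n) → ℝ → ℝ) (M : ℝ) : Prop :=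
  ∀ c ρ, 0 < ρ → ∫ y in ball c ρ, |b y - m c ρ| ≤ M * (ballVol n 1 * ρ ^ n)

lemma integrableOn_abs_sub_const {b : (E n) → ℝ} (hb : LocallyIntegrable b volume)
    (x : E n) (r t : ℝ) : IntegrableOn (fun y => |b y - t|) (ball x r) :=
  ((hb.integrableOn_ball x r).sub (integrableOn_const measure_ball_lt_top.ne)).abs

namespace MeanOscLE

variable {b : (E n) → ℝ} {m : (E n) → ℝ → ℝ} {M : ℝ}

lemma nonneg (h : MeanOscLE b m M) : 0 ≤ M := by
  have h1 := h 0 1 one_pos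
  have h2 : 0 ≤ ∫ y in ball (0 : E n) 1, |b y - m 0 1| := integral_nonneg fun _ => abs_nonneg _
  have h3 := ballVol_one_pos n
  rw [one_pow, mul_one] at h1
  exact nonneg_of_mul_nonneg_left (h2.trans h1) h3

lemma abs_sub_two_mul_le (h : MeanOscLE b m M) (hb : LocallyIntegrable b volume) (c : E n)
    {ρ : ℝ} (hρ : 0 < ρ) : |m c (2 * ρ) - m c ρ| ≤ (1 + 2 ^ n) * M := by
  have hv := ballVol_one_pos n
  have hV : 0 < ballVol n 1 * ρ ^ n := by positivity
  have i1 := integrableOn_abs_sub_const hb c ρ (m c ρ)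
  have i2 := integrableOn_abs_sub_const hb c (2 * ρ) (m c (2 * ρ))
  have hsub : ball c ρ ⊆ ball c (2 * ρ) := ball_subset_ball (by linarith)
  have h1 := h c ρ hρ
  have h2 := h c (2 * ρ) (by positivity)
  have h3 : ∫ y in ball c ρ, |b y - m c (2 * ρ)| ≤ ∫ y in ball c (2 * ρ), |b y - m c (2 * ρ)| :=
    setIntegral_mono_set i2 (ae_of_all _ fun _ => abs_nonneg _) hsub.eventuallyLE
  have h4 : ∫ _ in ball c ρ, |m c (2 * ρ) - m c ρ| ≤
      ∫ y in ball c ρ, (|b y - m c ρ| + |b y - m c (2 * ρ)|) := by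
    refine integral_mono (integrableOn_const measure_ball_lt_top.ne)
      (i1.add (i2.mono_set hsub)) fun y => ?_
    have := abs_sub (b y - m c ρ) (b y - m c (2 * ρ))
    simpa using this
  rw [integral_add i1 (i2.mono_set hsub), setIntegral_const, smul_eq_mul, measureReal_def,
    toReal_volume_ball c hρ] at h4
  refine le_of_mul_le_mul_left ?_ hV
  calc _ ≤ M * (ballVol n 1 * ρ ^ n) + M * (ballVol n 1 * (2 * ρ) ^ n) := by linarith
    _ = _ := by rw [mul_pow]; ring

lemma abs_sub_two_pow_mul_le (h : MeanOscLE b m M) (hb : LocallyIntegrable b volume) (c : E n)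
    {ρ : ℝ} (hρ : 0 < ρ) (j : ℕ) : |m c (2 ^ j * ρ) - m c ρ| ≤ j * ((1 + 2 ^ n) * M) := by
  induction j with
  | zero => simp
  | succ j ih =>
    have h1 := h.abs_sub_two_mul_le hb c (ρ := 2 ^ j * ρ) (by positivity)
    have h2 := abs_sub_le (m c (2 * (2 ^ j * ρ))) (m c (2 ^ j * ρ)) (m c ρ)
    rw [pow_succ', mul_assoc]
    push_cast
    linarith

end MeanOscLE

/-- The spherical shell swept by the spheres centred at the origin that meet `ball c r`. -/
def shell (c : E n) (r : ℝ) : Set (E n) := ball 0 (‖c‖ + r) \ ball 0 (‖c‖ - r)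

lemma measurableSet_shell (c : E n) (r : ℝ) : MeasurableSet (shell c r) :=
  measurableSet_ball.diff measurableSet_ball

lemma volume_real_shell_le (c : E n) {r : ℝ} (hr : 0 < r) (hn : 0 < n) :
    volume.real (shell c r) ≤
      ballVol n 1 * (‖c‖ + r) ^ n * (2 * n * r / (‖c‖ + r)) := by
  have hv := ballVol_one_pos n
  have hR : 0 < ‖c‖ + r := by positivity
  have hn1 : (1 : ℝ) ≤ n := by exact_mod_cast hn
  have hVR : volume.real (ball (0 : E n) (‖c‖ + r)) = ballVol n 1 * (‖c‖ + r) ^ n :=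
    toReal_volume_ball 0 hR
  rcases le_or_gt (‖c‖ - r) 0 with h | h
  · rw [shell, ball_eq_empty.2 h, Set.sdiff_empty, hVR]
    refine le_mul_of_one_le_right (by positivity) ?_
    rw [one_le_div hR]
    nlinarith
  · rw [shell, measureReal_sdiff (ball_subset_ball (by linarith)) measurableSet_ball, hVR,
      show volume.real (ball (0 : E n) (‖c‖ - r)) = ballVol n 1 * (‖c‖ - r) ^ n from
        toReal_volume_ball 0 h]
    have h1 := one_add_mul_le_pow (a := -(2 * r / (‖c‖ + r))) (by
      rw [neg_le_neg_iff, div_le_iff₀ hR]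
      nlinarith [norm_nonneg c]) n
    have h2 : (‖c‖ - r) ^ n = (‖c‖ + r) ^ n * (1 + -(2 * r / (‖c‖ + r))) ^ n := by
      rw [← mul_pow]
      congr 1
      field_simp
      ring
    have h3 := mul_le_mul_of_nonneg_left h1
      (show 0 ≤ ballVol n 1 * (‖c‖ + r) ^ n by positivity)
    rw [h2]
    calc _ ≤ ballVol n 1 * (‖c‖ + r) ^ n
          - ballVol n 1 * (‖c‖ + r) ^ n * (1 + n * -(2 * r / (‖c‖ + r))) := by linarith
      _ = _ := by ring

lemma MeanOscLE.setIntegral_shell_le {b : (E n) → ℝ} {m : (E n) → ℝ → ℝ} {M : ℝ}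
    (h : MeanOscLE b m M) (hb : LocallyIntegrable b volume) (hn : 0 < n) (c : E n) {r : ℝ}
    (hr : 0 < r) :
    ∫ y in shell c r, |b y - m c r| ≤
      (4 ^ n + 8 * n * (1 + 2 ^ n)) * M * (ballVol n 1 * (‖c‖ + r) ^ n) := by
  have hv := ballVol_one_pos n
  have hM := h.nonneg
  have hS := volume_real_shell_le c hr hn
  set R := ‖c‖ + r with hRdef
  have hR : 0 < R := by positivity
  have hrR : r ≤ R := by linarith [norm_nonneg c]
  obtain ⟨i, hi1, hi2⟩ := exists_nat_pow_near (x := 2 * R / r) (y := 2)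
    (by rw [one_le_div hr]; linarith) one_lt_two
  rw [le_div_iff₀ hr] at hi1
  rw [div_lt_iff₀ hr] at hi2
  set j := i + 1
  have hj1 : 2 ^ j * r ≤ 4 * R := by rw [pow_succ]; linarith
  have hj : (j : ℝ) ≤ 2 ^ j := by exact_mod_cast Nat.lt_two_pow_self.le
  have hsub : shell c r ⊆ ball c (2 ^ j * r) := by
    intro x hx
    have hx1 : ‖x‖ < R := by simpa using hx.1
    rw [mem_ball, dist_eq_norm]
    have := norm_sub_le x c
    linarith
  have hfin : volume (shell c r) ≠ ⊤ :=
    ((measure_mono Set.sdiff_subset).trans_lt measure_ball_lt_top).ne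
  have i1 := integrableOn_abs_sub_const hb c (2 ^ j * r) (m c (2 ^ j * r))
  have i2 := integrableOn_abs_sub_const hb c (2 ^ j * r) (m c r)
  have h1 : ∫ y in shell c r, |b y - m c r| ≤
      ∫ y in shell c r, (|b y - m c (2 ^ j * r)| + |m c (2 ^ j * r) - m c r|) :=
    integral_mono (i2.mono_set hsub)
      ((i1.mono_set hsub).add (integrableOn_const hfin)) fun y => abs_sub_le _ _ _
  rw [integral_add (i1.mono_set hsub) (integrableOn_const hfin), setIntegral_const,
    smul_eq_mul] at h1
  have h2 : ∫ y in shell c r, |b y - m c (2 ^ j * r)| ≤ M * (ballVol n 1 * (2 ^ j * r) ^ n) :=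
    (setIntegral_mono_set i1 (ae_of_all _ fun _ => abs_nonneg _) hsub.eventuallyLE).trans
      (h c _ (by positivity))
  have h3 : M * (ballVol n 1 * (2 ^ j * r) ^ n) ≤ M * (ballVol n 1 * (4 * R) ^ n) := by gcongr
  have h4 := mul_le_mul hS (h.abs_sub_two_pow_mul_le hb c hr j) (abs_nonneg _) (by positivity)
  have hjr : j * r / R ≤ 4 := by
    rw [div_le_iff₀ hR]
    exact (mul_le_mul_of_nonneg_right hj hr.le).trans hj1
  calc _ ≤ M * (ballVol n 1 * (4 * R) ^ n)
        + ballVol n 1 * R ^ n * (2 * n * r / R) * (j * ((1 + 2 ^ n) * M)) := by linarith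
    _ = 4 ^ n * M * (ballVol n 1 * R ^ n)
        + ballVol n 1 * R ^ n * (2 * n) * ((1 + 2 ^ n) * M) * (j * r / R) := by
      rw [mul_pow]; ring
    _ ≤ 4 ^ n * M * (ballVol n 1 * R ^ n)
        + ballVol n 1 * R ^ n * (2 * n) * ((1 + 2 ^ n) * M) * 4 := by gcongr
    _ = _ := by ring

namespace IsAtomInfZero

variable {a : (E n) → ℝ} {c : E n} {r : ℝ}

lemma integrable (ha : IsAtomInfZero n c r a) : Integrable a := by
  rw [← integrableOn_iff_integrable_of_support_subset (s := ball c r)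
    (fun x hx => by_contra fun h => hx (ha.2.1 x h))]
  exact Measure.integrableOn_of_bounded measure_ball_lt_top.ne ha.1.aestronglyMeasurable
    (ae_of_all _ ha.2.2.1)

lemma integral_abs_mul_le (ha : IsAtomInfZero n c r a) {g : (E n) → ℝ}
    (hg : IntegrableOn g (ball c r)) :
    Integrable (fun x => g x * a x) ∧
      ∫ x, |g x * a x| ≤ (∫ x in ball c r, |g x|) * ((volume (ball c r)).toReal)⁻¹ := by
  have hz : ∀ x, x ∉ ball c r → g x * a x = 0 := fun x hx => by rw [ha.2.1 x hx, mul_zero]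
  have hi : IntegrableOn (fun x => g x * a x) (ball c r) :=
    hg.mul_bdd (c := ((volume (ball c r)).toReal)⁻¹) ha.1.aestronglyMeasurable
      (ae_of_all _ ha.2.2.1)
  refine ⟨(integrableOn_iff_integrable_of_support_subset
    (fun x hx => by_contra fun h => hx (hz x h))).1 hi, ?_⟩
  rw [← setIntegral_eq_integral_of_forall_compl_eq_zero (s := ball c r)
    (fun x hx => by rw [hz x hx, abs_zero]), ← integral_mul_const]
  refine integral_mono hi.abs (hg.abs.mul_const _) fun x => ?_
  rw [abs_mul]
  exact mul_le_mul_of_nonneg_left (ha.2.2.1 x) (abs_nonneg _)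

lemma integral_abs_le_one (ha : IsAtomInfZero n c r a) : ∫ x, |a x| ≤ 1 := by
  have h := (ha.integral_abs_mul_le (g := fun _ => 1)
    (integrableOn_const measure_ball_lt_top.ne)).2
  simp only [one_mul, abs_one, setIntegral_const, smul_eq_mul, mul_one] at h
  exact h.trans mul_inv_le_one

lemma abs_hardyOp_le (ha : IsAtomInfZero n c r a) (hr : 0 < r) (x : E n) :
    |hardyOp n a x| ≤
      (shell c r).indicator (fun _ => (ballVol n 1 * ((‖c‖ + r) / 3) ^ n)⁻¹) x := by
  have hv := ballVol_one_pos n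
  have hW : 0 ≤ (ballVol n 1 * ‖x‖ ^ n)⁻¹ := by positivity
  by_cases hx : x ∈ shell c r
  · rw [Set.indicator_of_mem hx, hardyOp, abs_mul, abs_of_nonneg hW]
    rcases le_or_gt (2 * r) ‖c‖ with hc | hc
    · have hx2 : ‖c‖ - r ≤ ‖x‖ := by simpa using hx.2
      have h1 : |∫ y in ball (0 : E n) ‖x‖, a y| ≤ 1 :=
        (abs_integral_le_integral_abs).trans ((setIntegral_le_integral ha.integrable.abs
          (ae_of_all _ fun _ => abs_nonneg _)).trans ha.integral_abs_le_one)
      have hR : (‖c‖ + r) / 3 ≤ ‖x‖ := by linarith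
      calc _ ≤ (ballVol n 1 * ‖x‖ ^ n)⁻¹ * 1 := by gcongr
        _ ≤ _ := by
          rw [mul_one]
          gcongr
    · have h1 := norm_setIntegral_le_of_norm_le_const (f := a) (μ := volume)
        (s := ball (0 : E n) ‖x‖) (C := ((volume (ball c r)).toReal)⁻¹) measure_ball_lt_top
        (fun y _ => ha.2.2.1 y)
      rcases eq_or_ne x 0 with rfl | hx0
      · simp only [norm_zero, ball_zero, Measure.restrict_empty, integral_zero_measure, abs_zero,
          mul_zero]
        positivity
      have hx0' : 0 < ‖x‖ := norm_pos_iff.2 hx0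
      rw [measureReal_def, toReal_volume_ball _ hr, toReal_volume_ball _ hx0'] at h1
      calc _ ≤ (ballVol n 1 * ‖x‖ ^ n)⁻¹ * ((ballVol n 1 * r ^ n)⁻¹ * (ballVol n 1 * ‖x‖ ^ n)) :=
            mul_le_mul_of_nonneg_left h1 hW
        _ = (ballVol n 1 * r ^ n)⁻¹ := by field_simp
        _ ≤ _ := by
          gcongr
          linarith
  · rw [Set.indicator_of_notMem hx, abs_nonpos_iff, hardyOp]
    refine mul_eq_zero_of_right _ ?_
    rcases le_or_gt (‖c‖ + r) ‖x‖ with h | h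
    · rw [setIntegral_eq_integral_of_forall_compl_eq_zero, ha.2.2.2]
      intro y hy
      refine ha.2.1 y fun hyc => hy ?_
      rw [mem_ball, dist_eq_norm] at hyc
      rw [mem_ball_zero_iff]
      have := norm_le_norm_add_norm_sub' y c
      linarith
    · refine setIntegral_eq_zero_of_forall_eq_zero fun y hy => ha.2.1 y fun hyc => hx ⟨?_, ?_⟩
      · simpa using h
      · rw [mem_ball_zero_iff] at hy ⊢
        rw [mem_ball, dist_eq_norm] at hyc
        have := norm_le_norm_add_norm_sub y c
        linarith

lemma hasSum_setIntegral_mul {lam : ℕ → ℝ} {a : ℕ → (E n) → ℝ} {c : ℕ → E n} {r : ℕ → ℝ}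
    (ha : ∀ k, IsAtomInfZero n (c k) (r k) (a k)) (hlam : Summable fun k => |lam k|)
    {g : (E n) → ℝ} (hg : AEStronglyMeasurable g volume) {N : ℝ} (hN : ∀ x, |g x| ≤ N)
    (s : Set (E n)) :
    HasSum (fun k => lam k * ∫ y in s, g y * a k y) (∫ y in s, g y * ∑' k, lam k * a k y) := by
  have hi (k : ℕ) : Integrable (fun y => g y * a k y) :=
    (ha k).integrable.bdd_mul hg (ae_of_all _ hN)
  have hle (k : ℕ) : ∫ y in s, ‖lam k * (g y * a k y)‖ ≤ |lam k| * N := by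
    calc _ ≤ ∫ y, ‖lam k * (g y * a k y)‖ :=
          setIntegral_le_integral ((hi k).const_mul _).norm (ae_of_all _ fun _ => norm_nonneg _)
      _ ≤ ∫ y, |lam k| * N * |a k y| := by
        refine integral_mono ((hi k).const_mul _).norm
          ((ha k).integrable.abs.const_mul _) fun y => ?_
        simp only [Real.norm_eq_abs, abs_mul]
        rw [mul_assoc]
        gcongr
        exact hN y
      _ ≤ |lam k| * N := by
        rw [integral_const_mul]
        exact mul_le_of_le_one_right
          (mul_nonneg (abs_nonneg _) ((abs_nonneg _).trans (hN 0))) (ha k).integral_abs_le_one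
  have key := hasSum_integral_of_summable_integral_norm (μ := volume.restrict s)
    (F := fun k y => lam k * (g y * a k y)) (fun k => ((hi k).const_mul _).integrableOn)
    ((hlam.mul_right N).of_nonneg_of_le (fun k => integral_nonneg fun _ => norm_nonneg _) hle)
  simp only [integral_const_mul] at key
  simpa only [mul_left_comm (lam _), tsum_mul_left, integral_const_mul] using key

end IsAtomInfZero

lemma MeanOscLE.abs_setIntegral_mul_atom_le {b : (E n) → ℝ} {m : (E n) → ℝ → ℝ} {M : ℝ}
    (h : MeanOscLE b m M) (hb : LocallyIntegrable b volume) {a : (E n) → ℝ} {c : E n} {r : ℝ}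
    (hr : 0 < r) (ha : IsAtomInfZero n c r a) (s : Set (E n)) :
    |∫ y in s, (b y - m c r) * a y| ≤ M := by
  have hv := ballVol_one_pos n
  obtain ⟨hi, hle⟩ := ha.integral_abs_mul_le (g := fun y => b y - m c r)
    ((hb.integrableOn_ball c r).sub (integrableOn_const measure_ball_lt_top.ne))
  refine abs_integral_le_integral_abs.trans ((setIntegral_le_integral hi.abs
    (ae_of_all _ fun _ => abs_nonneg _)).trans (hle.trans ?_))
  rw [toReal_volume_ball c hr, ← div_eq_mul_inv, div_le_iff₀ (by positivity)]
  exact h c r hr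

lemma MeanOscLE.ofReal_abs_commutator_le {b : (E n) → ℝ} {m : (E n) → ℝ → ℝ} {M : ℝ}
    (h : MeanOscLE b m M) (hb : LocallyIntegrable b volume) {N : ℝ} (hN : ∀ x, |b x| ≤ N)
    {lam : ℕ → ℝ} {a : ℕ → (E n) → ℝ} {c : ℕ → E n} {r : ℕ → ℝ} (hr : ∀ k, 0 < r k)
    (ha : ∀ k, IsAtomInfZero n (c k) (r k) (a k)) (hlam : Summable fun k => |lam k|)
    {f : (E n) → ℝ} (hf : ∀ x, f x = ∑' k, lam k * a k x) (x : E n) :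
    ENNReal.ofReal |b x * hardyOp n f x - hardyOp n (fun y => b y * f y) x| ≤
      ∑' k, ENNReal.ofReal |lam k| *
        ENNReal.ofReal (|b x - m (c k) (r k)| * |hardyOp n (a k) x|) +
      ENNReal.ofReal ((ballVol n 1 * ‖x‖ ^ n)⁻¹ * (M * ∑' k, |lam k|)) := by
  have hv := ballVol_one_pos n
  have hM := h.nonneg
  have h1 := IsAtomInfZero.hasSum_setIntegral_mul ha hlam (g := fun _ => 1) (N := 1)
    aestronglyMeasurable_const (by simp) (ball 0 ‖x‖)
  have h2 := IsAtomInfZero.hasSum_setIntegral_mul ha hlam hb.aestronglyMeasurable hN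
    (ball 0 ‖x‖)
  simp only [one_mul, ← hf] at h1 h2
  set W := (ballVol n 1 * ‖x‖ ^ n)⁻¹ with hW
  have hW0 : 0 ≤ W := by positivity
  have h3 := (h1.mul_left (b x * W)).sub (h2.mul_left W)
  have hterm (k : ℕ) : b x * W * (lam k * ∫ y in ball 0 ‖x‖, a k y) -
      W * (lam k * ∫ y in ball 0 ‖x‖, b y * a k y) =
      lam k * ((b x - m (c k) (r k)) * hardyOp n (a k) x -
        W * ∫ y in ball 0 ‖x‖, (b y - m (c k) (r k)) * a k y) := by
    have hba : Integrable (fun y => b y * a k y) :=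
      (ha k).integrable.bdd_mul hb.aestronglyMeasurable (ae_of_all _ hN)
    simp only [sub_mul]
    rw [integral_sub hba.integrableOn ((ha k).integrable.const_mul _).integrableOn,
      integral_const_mul, hardyOp, ← hW]
    ring
  simp only [hterm] at h3
  have hF : b x * hardyOp n f x - hardyOp n (fun y => b y * f y) x =
      b x * W * (∫ y in ball 0 ‖x‖, f y) - W * ∫ y in ball 0 ‖x‖, b y * f y := by
    simp only [hardyOp, ← hW]
    ring
  rw [hF, ← h3.tsum_eq, ← Real.enorm_eq_ofReal_abs]
  refine enorm_tsum_le_tsum_enorm.trans ?_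
  rw [← mul_assoc, ← tsum_mul_left,
    ENNReal.ofReal_tsum_of_nonneg (fun k => by positivity) (hlam.mul_left _), ← ENNReal.tsum_add]
  refine ENNReal.tsum_le_tsum fun k => ?_
  rw [← ENNReal.ofReal_mul (abs_nonneg _), ← ENNReal.ofReal_add (by positivity) (by positivity),
    Real.enorm_eq_ofReal_abs]
  refine ENNReal.ofReal_le_ofReal ?_
  rw [abs_mul, mul_comm (W * M), ← mul_add]
  refine mul_le_mul_of_nonneg_left ((abs_sub _ _).trans ?_) (abs_nonneg _)
  rw [abs_mul, abs_mul, abs_of_nonneg hW0]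
  gcongr
  exact h.abs_setIntegral_mul_atom_le hb (hr k) (ha k) _

lemma volume_setOf_ballVol_mul_pow_lt_le (hn : 0 < n) (t : ℝ) :
    volume {x : E n | ballVol n 1 * ‖x‖ ^ n < t} ≤ ENNReal.ofReal t := by
  have hv := ballVol_one_pos n
  rcases le_or_gt t 0 with ht | ht
  · have : {x : E n | ballVol n 1 * ‖x‖ ^ n < t} = ∅ := by
      ext x
      have : 0 ≤ ballVol n 1 * ‖x‖ ^ n := by positivity
      simpa using ht.trans this
    simp [this]
  · have hρ : 0 < (t / ballVol n 1) ^ (n : ℝ)⁻¹ := by positivity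
    have hpow : ((t / ballVol n 1) ^ (n : ℝ)⁻¹) ^ n = t / ballVol n 1 :=
      Real.rpow_inv_natCast_pow (by positivity) hn.ne'
    refine (measure_mono (t := ball (0 : E n) ((t / ballVol n 1) ^ (n : ℝ)⁻¹)) fun x hx => ?_).trans
      (le_of_eq ?_)
    · rw [mem_ball_zero_iff]
      refine lt_of_pow_lt_pow_left₀ n hρ.le ?_
      rw [hpow, lt_div_iff₀' hv]
      exact hx
    · rw [← ENNReal.ofReal_toReal measure_ball_lt_top.ne, toReal_volume_ball _ hρ, hpow,
        mul_div_cancel₀ _ hv.ne']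

lemma MeanOscLE.lintegral_indicator_shell_le {b : (E n) → ℝ} {m : (E n) → ℝ → ℝ} {M : ℝ}
    (h : MeanOscLE b m M) (hb : LocallyIntegrable b volume) (hn : 0 < n) (c : E n) {r : ℝ}
    (hr : 0 < r) :
    ∫⁻ x, ENNReal.ofReal (|b x - m c r| *
        (shell c r).indicator (fun _ => (ballVol n 1 * ((‖c‖ + r) / 3) ^ n)⁻¹) x) ≤
      ENNReal.ofReal (3 ^ n * (4 ^ n + 8 * n * (1 + 2 ^ n)) * M) := by
  have hv := ballVol_one_pos n
  have hR : 0 < ‖c‖ + r := by positivity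
  set K := (ballVol n 1 * ((‖c‖ + r) / 3) ^ n)⁻¹ with hK
  have hK0 : 0 ≤ K := by positivity
  have heq (x : E n) : ENNReal.ofReal (|b x - m c r| * (shell c r).indicator (fun _ => K) x) =
      (shell c r).indicator (fun x => ENNReal.ofReal (|b x - m c r| * K)) x := by
    by_cases hx : x ∈ shell c r <;> simp [hx]
  have hi : IntegrableOn (fun x => |b x - m c r| * K) (shell c r) :=
    ((integrableOn_abs_sub_const hb 0 (‖c‖ + r) (m c r)).mono_set
    (Set.sdiff_subset (t := ball 0 (‖c‖ - r)))).mul_const K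
  simp only [heq]
  rw [lintegral_indicator (measurableSet_shell c r), ← ofReal_integral_eq_lintegral_ofReal hi
    (ae_of_all _ fun _ => mul_nonneg (abs_nonneg _) hK0), integral_mul_const]
  refine ENNReal.ofReal_le_ofReal ?_
  calc _ ≤ (4 ^ n + 8 * n * (1 + 2 ^ n)) * M * (ballVol n 1 * (‖c‖ + r) ^ n) * K :=
        mul_le_mul_of_nonneg_right (h.setIntegral_shell_le hb hn c hr) hK0
    _ = _ := by
      rw [hK, div_pow]
      field_simp

lemma MeanOscLE.weak_type_of_bounded {b : (E n) → ℝ} {m : (E n) → ℝ → ℝ} {M : ℝ}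
    (h : MeanOscLE b m M) (hn : 0 < n) (hb : LocallyIntegrable b volume) {N : ℝ}
    (hN : ∀ x, |b x| ≤ N)
    {lam : ℕ → ℝ} {a : ℕ → (E n) → ℝ} {c : ℕ → E n} {r : ℕ → ℝ} (hr : ∀ k, 0 < r k)
    (ha : ∀ k, IsAtomInfZero n (c k) (r k) (a k)) (hlam : Summable fun k => |lam k|)
    {f : (E n) → ℝ} (hf : ∀ x, f x = ∑' k, lam k * a k x) {lev : ℝ} (hlev : 0 < lev) :
    ENNReal.ofReal lev *
        volume {x | lev < |b x * hardyOp n f x - hardyOp n (fun y => b y * f y) x|} ≤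
      ENNReal.ofReal ((2 * (3 ^ n * (4 ^ n + 8 * n * (1 + 2 ^ n))) + 2) * M * ∑' k, |lam k|) := by
  have hM := h.nonneg
  have hS : 0 ≤ ∑' k, |lam k| := tsum_nonneg fun _ => abs_nonneg _
  set A : ℝ := 3 ^ n * (4 ^ n + 8 * n * (1 + 2 ^ n)) with hA
  have hA0 : 0 ≤ A := by positivity
  set T := M * ∑' k, |lam k| with hT
  have hT0 : 0 ≤ T := by positivity
  set G : ℕ → (E n) → ENNReal := fun k x => ENNReal.ofReal |lam k| *
    ENNReal.ofReal (|b x - m (c k) (r k)| * (shell (c k) (r k)).indicator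
      (fun _ => (ballVol n 1 * ((‖c k‖ + r k) / 3) ^ n)⁻¹) x) with hG
  have hGm (k : ℕ) : AEMeasurable (fun x => ENNReal.ofReal (|b x - m (c k) (r k)| *
      (shell (c k) (r k)).indicator
      (fun _ => (ballVol n 1 * ((‖c k‖ + r k) / 3) ^ n)⁻¹) x)) volume := by
    have hbm : AEMeasurable b volume := hb.aestronglyMeasurable.aemeasurable
    have hind : Measurable ((shell (c k) (r k)).indicator
      (fun _ => (ballVol n 1 * ((‖c k‖ + r k) / 3) ^ n)⁻¹)) :=
      measurable_const.indicator (measurableSet_shell _ _)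
    have habs : AEMeasurable (fun x => |b x - m (c k) (r k)|) volume :=
      continuous_abs.measurable.comp_aemeasurable (hbm.sub_const _)
    exact (habs.mul hind.aemeasurable).ennreal_ofReal
  have hGint : ∫⁻ x, ∑' k, G k x ≤ ENNReal.ofReal (A * T) := by
    rw [lintegral_tsum fun k => (hGm k).const_mul _]
    calc _ ≤ ∑' k, ENNReal.ofReal |lam k| * ENNReal.ofReal (A * M) := by
          refine ENNReal.tsum_le_tsum fun k => ?_
          rw [lintegral_const_mul'' _ (hGm k)]
          gcongr
          exact h.lintegral_indicator_shell_le hb hn (c k) (hr k)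
      _ = _ := by
        rw [ENNReal.tsum_mul_right, ← ENNReal.ofReal_tsum_of_nonneg (fun _ => abs_nonneg _) hlam,
          ← ENNReal.ofReal_mul hS, hT]
        ring_nf
  have hsub : {x | lev < |b x * hardyOp n f x - hardyOp n (fun y => b y * f y) x|} ⊆
      {x | ENNReal.ofReal (lev / 2) ≤ ∑' k, G k x} ∪
        {x : E n | ballVol n 1 * ‖x‖ ^ n < 2 * T / lev} := by
    intro x hx
    by_contra hcon
    rw [Set.mem_union, not_or] at hcon
    obtain ⟨h1, h2⟩ := hcon
    simp only [Set.mem_ofPred_eq, not_le, not_lt] at h1 h2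
    have h3 : (ballVol n 1 * ‖x‖ ^ n)⁻¹ * T ≤ lev / 2 := by
      rcases eq_or_ne x 0 with rfl | hx0
      · simpa [hn.ne'] using (half_pos hlev).le
      · have hv := ballVol_one_pos n
        have hx0' : 0 < ‖x‖ := norm_pos_iff.2 hx0
        rw [inv_mul_le_iff₀ (by positivity)]
        rw [div_le_iff₀ hlev] at h2
        linarith
    have h4 := h.ofReal_abs_commutator_le hb hN hr ha hlam hf x
    have h5 : ∑' k, ENNReal.ofReal |lam k| *
        ENNReal.ofReal (|b x - m (c k) (r k)| * |hardyOp n (a k) x|) ≤ ∑' k, G k x := by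
      refine ENNReal.tsum_le_tsum fun k => ?_
      simp only [hG]
      gcongr
      exact (ha k).abs_hardyOp_le (hr k) x
    have h6 := h4.trans_lt (ENNReal.add_lt_add_of_lt_of_le ENNReal.ofReal_ne_top
      (h5.trans_lt h1) (ENNReal.ofReal_le_ofReal h3))
    rw [← ENNReal.ofReal_add (by positivity) (by positivity), add_halves,
      ENNReal.ofReal_lt_ofReal_iff hlev] at h6
    exact lt_asymm h6 hx
  have hm1 := (mul_meas_ge_le_lintegral₀ (AEMeasurable.tsum fun k => (hGm k).const_mul _)
    (ENNReal.ofReal (lev / 2))).trans hGint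
  have hm2 := volume_setOf_ballVol_mul_pow_lt_le hn (2 * T / lev)
  calc _ ≤ ENNReal.ofReal lev * (volume {x | ENNReal.ofReal (lev / 2) ≤ ∑' k, G k x} +
          volume {x : E n | ballVol n 1 * ‖x‖ ^ n < 2 * T / lev}) := by
        gcongr
        exact (measure_mono hsub).trans (measure_union_le _ _)
    _ = ENNReal.ofReal 2 * (ENNReal.ofReal (lev / 2) *
          volume {x | ENNReal.ofReal (lev / 2) ≤ ∑' k, G k x}) +
        ENNReal.ofReal lev * volume {x : E n | ballVol n 1 * ‖x‖ ^ n < 2 * T / lev} := by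
      rw [mul_add, ← mul_assoc (ENNReal.ofReal 2), ← ENNReal.ofReal_mul two_pos.le,
        mul_div_cancel₀ _ two_ne_zero]
    _ ≤ ENNReal.ofReal 2 * ENNReal.ofReal (A * T) +
        ENNReal.ofReal lev * ENNReal.ofReal (2 * T / lev) := by gcongr
    _ = _ := by
      rw [← ENNReal.ofReal_mul two_pos.le, ← ENNReal.ofReal_mul hlev.le,
        ← ENNReal.ofReal_add (by positivity) (by positivity), hT]
      congr 1
      field_simp

/-- Truncation of a real number at height `N`. -/
noncomputable def truncAt (N s : ℝ) : ℝ := max (-N) (min s N)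

lemma continuous_truncAt (N : ℝ) : Continuous (truncAt N) := by
  unfold truncAt
  fun_prop

lemma abs_truncAt_le {N : ℝ} (hN : 0 ≤ N) (s : ℝ) : |truncAt N s| ≤ N := by
  rw [truncAt, abs_le]
  exact ⟨le_max_left _ _, max_le (by linarith) (min_le_right _ _)⟩

lemma abs_truncAt_sub_le (N s t : ℝ) : |truncAt N s - truncAt N t| ≤ |s - t| := by
  rw [truncAt, truncAt, max_comm, max_comm (-N)]
  exact (abs_max_sub_max_le_abs _ _ _).trans (abs_inf_sub_inf_le_abs s t N)

lemma truncAt_of_abs_le {N s : ℝ} (h : |s| ≤ N) : truncAt N s = s := by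
  rw [abs_le] at h
  rw [truncAt, min_eq_left h.2, max_eq_right h.1]

lemma abs_truncAt_le_abs {N : ℝ} (hN : 0 ≤ N) (s : ℝ) : |truncAt N s| ≤ |s| := by
  have := abs_truncAt_sub_le N s 0
  rwa [truncAt_of_abs_le (s := 0) (by simpa using hN), sub_zero, sub_zero] at this

lemma eventually_truncAt_eq (s : ℝ) : ∀ᶠ N : ℕ in Filter.atTop, truncAt N s = s := by
  filter_upwards [Filter.eventually_ge_atTop ⌈|s|⌉₊] with N hN
  exact truncAt_of_abs_le (Nat.ceil_le.1 hN)

lemma MeasureTheory.LocallyIntegrable.truncAt {b : (E n) → ℝ} (hb : LocallyIntegrable b volume)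
    {N : ℝ} (hN : 0 ≤ N) : LocallyIntegrable (fun x => truncAt N (b x)) volume :=
  hb.mono ((continuous_truncAt N).comp_aestronglyMeasurable hb.aestronglyMeasurable)
    (ae_of_all _ fun x => abs_truncAt_le_abs hN (b x))

lemma MeanOscLE.truncAt {b : (E n) → ℝ} {m : (E n) → ℝ → ℝ} {M : ℝ} (h : MeanOscLE b m M)
    (hb : LocallyIntegrable b volume) {N : ℝ} (hN : 0 ≤ N) :
    MeanOscLE (fun x => truncAt N (b x)) (fun c ρ => truncAt N (m c ρ)) M := fun c ρ hρ =>
  (integral_mono (integrableOn_abs_sub_const (hb.truncAt hN) c ρ _)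
    (integrableOn_abs_sub_const hb c ρ _) fun _ => abs_truncAt_sub_le N _ _).trans (h c ρ hρ)

lemma tendsto_commutator_truncAt {b f : (E n) → ℝ} (hb : LocallyIntegrable b volume)
    (hbf : LocallyIntegrable (fun y => b y * f y) volume) (x : E n) :
    Filter.Tendsto (fun N : ℕ => truncAt N (b x) * hardyOp n f x -
        hardyOp n (fun y => truncAt N (b y) * f y) x) Filter.atTop
      (nhds (b x * hardyOp n f x - hardyOp n (fun y => b y * f y) x)) := by
  have htr (s : ℝ) : Filter.Tendsto (fun N : ℕ => truncAt N s) Filter.atTop (nhds s) :=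
    tendsto_nhds_of_eventually_eq (eventually_truncAt_eq s)
  refine ((htr (b x)).mul_const _).sub (Filter.Tendsto.const_mul _ ?_)
  have hi := hbf.integrableOn_ball 0 ‖x‖
  refine tendsto_integral_of_dominated_convergence (fun y => |b y * f y|) (fun N => ?_) hi.abs
    (fun N => ae_of_all _ fun y => ?_) (ae_of_all _ fun y => (htr (b y)).mul_const _)
  · have hbm : AEMeasurable b (volume.restrict (ball (0 : E n) ‖x‖)) :=
      hb.aestronglyMeasurable.aemeasurable.restrict
    have heq : (fun y => truncAt N (b y) * f y) =
        fun y => truncAt N (b y) / b y * (b y * f y) := by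
      ext y
      rcases eq_or_ne (b y) 0 with h0 | h0
      · rw [h0, truncAt_of_abs_le (by simp)]
        simp
      · field_simp
    rw [heq]
    exact ((((continuous_truncAt N).measurable.comp_aemeasurable hbm).div hbm).mul
      hi.aestronglyMeasurable.aemeasurable).aestronglyMeasurable
  · rw [Real.norm_eq_abs, abs_mul, abs_mul]
    exact mul_le_mul_of_nonneg_right (abs_truncAt_le_abs N.cast_nonneg _) (abs_nonneg _)

lemma mul_measure_lt_abs_le_of_tendsto {α : Type*} [MeasurableSpace α] {μ : Measure α}
    {F : ℕ → α → ℝ} {f : α → ℝ}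
    (hF : ∀ x, Filter.Tendsto (fun N => F N x) Filter.atTop (nhds (f x))) {t : ℝ}
    {p q : ENNReal} (h : ∀ N, p * μ {x | t < |F N x|} ≤ q) : p * μ {x | t < |f x|} ≤ q := by
  set S : ℕ → Set α := fun N => {x | ∀ j, N ≤ j → t < |F j x|}
  have hmono : Monotone S := fun N K hNK x hx j hj => hx j (hNK.trans hj)
  have hsub : {x | t < |f x|} ⊆ ⋃ N, S N := by
    intro x hx
    obtain ⟨N, hN⟩ := Filter.eventually_atTop.1 ((hF x).abs.eventually_const_lt hx)
    exact Set.mem_iUnion.2 ⟨N, hN⟩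
  calc _ ≤ p * μ (⋃ N, S N) := by gcongr
    _ = ⨆ N, p * μ (S N) := by rw [hmono.measure_iUnion, ENNReal.mul_iSup]
    _ ≤ q := iSup_le fun N => by
      have hN : S N ⊆ {x | t < |F N x|} := fun x hx => hx N le_rfl
      exact (mul_le_mul_right (measure_mono hN) p).trans (h N)

end HardyCommutator

/-- For `b ∈ BMO(ℝⁿ)` (with BMO bound `M`), the commutator `[b,ℋ]f = b·ℋf - ℋ(bf)`
maps `H¹(ℝⁿ)` to weak `L¹(ℝⁿ)`: there is `C = C(n) > 0` such that for every
`f = Σ λₖ aₖ ∈ H¹` (atomic decomposition into `(1,∞,0)`-atoms) and every `λ > 0`,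
`λ·|{x : |[b,ℋ]f(x)| > λ}| ≤ C·M·Σ|λₖ| ≤ C‖b‖_{BMO}‖f‖_{H¹}`. -/
theorem commutator_H1_to_weak_L1 (n : ℕ) (hn : 0 < n) :
    ∃ C : ℝ, 0 < C ∧ ∀ (b : EuclideanSpace ℝ (Fin n) → ℝ),
      LocallyIntegrable b volume → ∀ M : ℝ,
      (∀ (c : EuclideanSpace ℝ (Fin n)) (ρ : ℝ), 0 < ρ →
        (⨍ y in ball c ρ, |b y - ⨍ z in ball c ρ, b z|) ≤ M) →
      ∀ (f : EuclideanSpace ℝ (Fin n) → ℝ) (lam : ℕ → ℝ)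
        (a : ℕ → EuclideanSpace ℝ (Fin n) → ℝ) (c : ℕ → EuclideanSpace ℝ (Fin n))
        (r : ℕ → ℝ), (∀ k, 0 < r k) → (∀ k, IsAtomInfZero n (c k) (r k) (a k)) →
        Summable (fun k => |lam k|) → (∀ x, f x = ∑' k, lam k * a k x) →
        LocallyIntegrable (fun y => b y * f y) volume →
        ∀ lev : ℝ, 0 < lev →
          ENNReal.ofReal lev *
              volume {x | lev < |b x * hardyOp n f x - hardyOp n (fun y => b y * f y) x|} ≤
            ENNReal.ofReal (C * M * ∑' k, |lam k|) := by
  refine ⟨2 * (3 ^ n * (4 ^ n + 8 * n * (1 + 2 ^ n))) + 2, by positivity, ?_⟩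
  intro b hb M hosc f lam a c r hr ha hlam hf hbf lev hlev
  have hM : MeanOscLE b (fun c ρ => ⨍ z in ball c ρ, b z) M := by
    intro c ρ hρ
    have hv := ballVol_one_pos n
    have h1 := hosc c ρ hρ
    rw [setAverage_eq volume (fun y => |b y - ⨍ z in ball c ρ, b z|), smul_eq_mul, measureReal_def,
      toReal_volume_ball c hρ, inv_mul_le_iff₀ (by positivity)] at h1
    linarith
  exact mul_measure_lt_abs_le_of_tendsto (tendsto_commutator_truncAt hb hbf) fun N =>
    (hM.truncAt hb N.cast_nonneg).weak_type_of_bounded hn (hb.truncAt N.cast_nonneg)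
      (fun x => abs_truncAt_le N.cast_nonneg (b x)) hr ha hlam hf hlev
end

section
/- BMO(ℝⁿ) is properly contained in CBMO^q(ℝⁿ) for 1 ≤ q < ∞: every b ∈ BMO(ℝⁿ) satisfies ‖b‖_{CBMO^q} ≤ C‖b‖_{BMO}, but there exists b ∈ CBMO^q(ℝⁿ) with b ∉ BMO(ℝⁿ). -/
open MeasureTheory Metric

open Filter Topology Module

section JohnNirenberg

variable {E : Type*} [NormedAddCommGroup E] [NormedSpace ℝ E] [FiniteDimensional ℝ E]
  [MeasurableSpace E] [BorelSpace E] {μ : Measure E} [μ.IsAddHaarMeasure]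

/-- The mean of `b` over the closed ball of centre `c` and radius `r`. -/
noncomputable def ballMean (μ : Measure E) (b : E → ℝ) (c : E) (r : ℝ) : ℝ :=
  ⨍ z in closedBall c r, b z ∂μ

/-- The mean oscillation of `b` over every closed ball is at most `M`. -/
def MeanOscillationLE (μ : Measure E) (b : E → ℝ) (M : ℝ) : Prop :=
  ∀ (c : E) (r : ℝ), 0 < r →
    ∫⁻ y in closedBall c r, ENNReal.ofReal |b y - ballMean μ b c r| ∂μ ≤
      ENNReal.ofReal M * μ (closedBall c r)

theorem closedBall_ae_eq_ball_of_pos (c : E) {r : ℝ} (hr : 0 < r) :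
    (closedBall c r : Set E) =ᵐ[μ] ball c r := by
  refine (ae_eq_of_subset_of_measure_ge ball_subset_closedBall ?_
    measurableSet_ball.nullMeasurableSet measure_closedBall_lt_top.ne).symm
  rw [Measure.addHaar_closedBall μ c hr.le, Measure.addHaar_ball_of_pos μ c hr]

/-- The distance from a constant to the mean of a function is at most the mean distance. -/
theorem ofReal_abs_average_sub_mul_le {α : Type*} [MeasurableSpace α] {ν : Measure α}
    {s : Set α} {b : α → ℝ} (hb : IntegrableOn b s ν) (hs : ν s ≠ ⊤) (a : ℝ) :
    ENNReal.ofReal |(⨍ z in s, b z ∂ν) - a| * ν s ≤ ∫⁻ y in s, ENNReal.ofReal |b y - a| ∂ν := by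
  by_cases h0 : ν s = 0
  · simp [h0]
  have hpos : 0 < ν.real s := ENNReal.toReal_pos h0 hs
  have hconst : IntegrableOn (fun _ : α => a) s ν := integrableOn_const hs
  have key : ((⨍ z in s, b z ∂ν) - a) * ν.real s = ∫ y in s, (b y - a) ∂ν := by
    rw [integral_sub hb hconst, setAverage_eq, setIntegral_const]
    simp only [smul_eq_mul]
    field_simp
  have h1 : |(⨍ z in s, b z ∂ν) - a| * ν.real s ≤ ∫ y in s, |b y - a| ∂ν := by
    rw [← abs_of_nonneg hpos.le (a := ν.real s), ← abs_mul, key]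
    exact abs_integral_le_integral_abs
  calc ENNReal.ofReal |(⨍ z in s, b z ∂ν) - a| * ν s
      = ENNReal.ofReal (|(⨍ z in s, b z ∂ν) - a| * ν.real s) := by
        rw [ENNReal.ofReal_mul (abs_nonneg _), measureReal_def, ENNReal.ofReal_toReal hs]
    _ ≤ ENNReal.ofReal (∫ y in s, |b y - a| ∂ν) := ENNReal.ofReal_le_ofReal h1
    _ = _ := ofReal_integral_eq_lintegral_ofReal (hb.sub hconst).abs
        (Eventually.of_forall fun _ => abs_nonneg _)

theorem measure_closedBall_le_of_le_mul (x y : E) {r s κ : ℝ} (hr : 0 < r) (hs : 0 ≤ s)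
    (hκ : 0 ≤ κ) (h : s ≤ κ * r) :
    μ (closedBall y s) ≤ ENNReal.ofReal (κ ^ finrank ℝ E) * μ (closedBall x r) := by
  rw [Measure.addHaar_closedBall' μ y hs, Measure.addHaar_closedBall' μ x hr.le, ← mul_assoc,
    ← ENNReal.ofReal_mul (by positivity), ← mul_pow]
  gcongr

theorem MeanOscillationLE.abs_ballMean_sub_le {b : E → ℝ} {M : ℝ} (h : MeanOscillationLE μ b M)
    (hb : LocallyIntegrable b μ) (hM : 0 ≤ M) {x y : E} {r s κ : ℝ} (hr : 0 < r) (hs : 0 < s)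
    (hκ : 0 ≤ κ) (hsub : closedBall x r ⊆ closedBall y s) (hle : s ≤ κ * r) :
    |ballMean μ b x r - ballMean μ b y s| ≤ κ ^ finrank ℝ E * M := by
  have hpos : μ (closedBall x r) ≠ 0 := (measure_closedBall_pos μ x hr).ne'
  have hfin : μ (closedBall x r) ≠ ⊤ := measure_closedBall_lt_top.ne
  have h1 := calc
    ENNReal.ofReal |ballMean μ b x r - ballMean μ b y s| * μ (closedBall x r)
      ≤ ∫⁻ z in closedBall x r, ENNReal.ofReal |b z - ballMean μ b y s| ∂μ :=
        ofReal_abs_average_sub_mul_le (hb.integrableOn_isCompact (isCompact_closedBall x r)) hfin _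
    _ ≤ ∫⁻ z in closedBall y s, ENNReal.ofReal |b z - ballMean μ b y s| ∂μ :=
        lintegral_mono_set hsub
    _ ≤ ENNReal.ofReal M * μ (closedBall y s) := h y s hs
    _ ≤ ENNReal.ofReal M * (ENNReal.ofReal (κ ^ finrank ℝ E) * μ (closedBall x r)) := by
        gcongr
        exact measure_closedBall_le_of_le_mul x y hr hs.le hκ hle
    _ = ENNReal.ofReal (κ ^ finrank ℝ E * M) * μ (closedBall x r) := by
        rw [ENNReal.ofReal_mul (by positivity)]
        ring
  rw [ENNReal.mul_le_mul_iff_left hpos hfin, ENNReal.ofReal_le_ofReal_iff (by positivity)] at h1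
  exact h1

/-- The step by which the level must grow for the distribution function of a function of mean
oscillation at most one on a `d`-dimensional space to be halved. -/
def johnNirenbergStep (d : ℕ) : ℝ := 2 * 10 ^ d + 5 ^ d + 2 ^ d

theorem johnNirenbergStep_pos (d : ℕ) : 0 < johnNirenbergStep d := by
  unfold johnNirenbergStep
  positivity

theorem ae_abs_sub_le_of_forall_ballMean {b : E → ℝ} (hb : LocallyIntegrable b μ)
    {a l R : ℝ} (hR : 0 < R) :
    ∀ᵐ x ∂μ, (∀ j : ℕ, |ballMean μ b x (R * (1 / 2) ^ j) - a| ≤ l) → |b x - a| ≤ l := by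
  filter_upwards [IsUnifLocDoublingMeasure.ae_tendsto_average μ hb 1] with x hx hle
  have hδ : Tendsto (fun j : ℕ => R * (1 / 2 : ℝ) ^ j) atTop (𝓝[>] 0) := by
    refine tendsto_nhdsWithin_iff.2 ⟨?_, Eventually.of_forall fun j => ?_⟩
    · simpa using (tendsto_pow_atTop_nhds_zero_of_lt_one (by norm_num : (0 : ℝ) ≤ 1 / 2)
        (by norm_num)).const_mul R
    · exact Set.mem_Ioi.2 (by positivity)
  have ht := hx (fun _ => x) _ hδ
    (Eventually.of_forall fun j => mem_closedBall_self (by positivity))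
  exact le_of_tendsto (ht.sub_const a).abs (Eventually.of_forall hle)

/-- One step of the John–Nirenberg iteration. -/
theorem MeanOscillationLE.measure_lt_abs_sub_step {b : E → ℝ} {M : ℝ}
    (h : MeanOscillationLE μ b M) (hb : LocallyIntegrable b μ) (hM : 0 < M) {t : ℝ} (ht : 0 ≤ t)
    {θ : ENNReal}
    (hθ : ∀ (c : E) (r : ℝ), 0 < r →
      μ {x ∈ closedBall c r | t < |b x - ballMean μ b c r|} ≤ θ * μ (closedBall c r))
    (c : E) {R : ℝ} (hR : 0 < R) :
    μ {x ∈ closedBall c R | t + johnNirenbergStep (finrank ℝ E) * M < |b x - ballMean μ b c R|} ≤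
      θ * 2⁻¹ * μ (closedBall c R) := by
  set d := finrank ℝ E
  set a := ballMean μ b c (2 * R)
  set l : ℝ := 2 * 10 ^ d * M with hl
  have hl0 : 0 < l := by positivity
  let rad : ℕ → ℝ := fun j => R * (1 / 2) ^ j
  have hrad : ∀ j, 0 < rad j := fun j => by positivity
  have hradle : ∀ j, rad j ≤ R := fun j =>
    mul_le_of_le_one_right hR.le (pow_le_one₀ (by norm_num) (by norm_num))
  have exists_radius : ∀ x ∈ closedBall c R, (∃ j, l < |ballMean μ b x (rad j) - a|) →
      ∃ r, 0 < r ∧ r ≤ R ∧ l < |ballMean μ b x r - a| ∧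
        |ballMean μ b x (5 * r) - a| ≤ l + 5 ^ d * M := by
    classical
    intro x hx hex
    have hspec := Nat.find_spec hex
    have hmin := fun k => Nat.find_min hex (m := k)
    set j := Nat.find hex
    have hj : j ≠ 0 := by
      intro hj0
      rw [hj0] at hspec
      have h2 : |ballMean μ b x (rad 0) - a| ≤ 2 ^ d * M := by
        refine h.abs_ballMean_sub_le hb hM.le (hrad 0) (by positivity) (by norm_num) ?_ ?_
        · refine closedBall_subset_closedBall' ?_
          have := mem_closedBall.1 hx
          have := hradle 0
          linarith
        · simp [rad]
      have : (2 : ℝ) ^ d ≤ 2 * 10 ^ d := by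
        have : (2 : ℝ) ^ d ≤ 10 ^ d := by gcongr; norm_num
        have : (0 : ℝ) < 10 ^ d := by positivity
        linarith
      have : (2 : ℝ) ^ d * M ≤ l := mul_le_mul_of_nonneg_right this hM.le
      linarith
    obtain ⟨k, hk⟩ := Nat.exists_eq_succ_of_ne_zero hj
    refine ⟨rad j, hrad j, hradle j, hspec, ?_⟩
    have h2r : rad k = 2 * rad j := by
      simp only [rad, hk, Nat.succ_eq_add_one, pow_succ]
      ring
    have h1 : |ballMean μ b x (2 * rad j) - a| ≤ l := by
      rw [← h2r]
      exact not_lt.1 (hmin k (by omega))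
    have hrj := hrad j
    have h3 : |ballMean μ b x (2 * rad j) - ballMean μ b x (5 * rad j)| ≤ 5 ^ d * M :=
      h.abs_ballMean_sub_le hb hM.le (by positivity) (by positivity) (by norm_num)
        (closedBall_subset_closedBall (by linarith)) (by linarith)
    rw [abs_sub_comm] at h3
    have := abs_sub_le (ballMean μ b x (5 * rad j)) (ballMean μ b x (2 * rad j)) a
    linarith
  choose! r hr0 hrR hrl hr5 using exists_radius
  set T : Set E := {x ∈ closedBall c R | ∃ j, l < |ballMean μ b x (rad j) - a|}
  obtain ⟨u, huT, hdisj, hcov⟩ :=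
    Vitali.exists_disjoint_subfamily_covering_enlargement_closedBall T id r R
      (fun x hx => hrR x hx.1 hx.2) 5 (by norm_num)
  simp only [id] at hdisj hcov
  have hucount : u.Countable := hdisj.countable_of_nonempty_interior fun x hx => by
    have hx' := huT hx
    exact ⟨x, ball_subset_interior_closedBall (mem_ball_self (hr0 x hx'.1 hx'.2))⟩
  have hcmean : |ballMean μ b c R - a| ≤ 2 ^ d * M :=
    h.abs_ballMean_sub_le hb hM.le hR (by positivity) (by norm_num)
      (closedBall_subset_closedBall (by linarith)) le_rfl
  have hcover : ({x ∈ closedBall c R | t + johnNirenbergStep d * M < |b x - ballMean μ b c R|}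
      : Set E) ≤ᵐ[μ]
      (⋃ i ∈ u, {x ∈ closedBall i (5 * r i) | t < |b x - ballMean μ b i (5 * r i)|} : Set E) := by
    filter_upwards [ae_abs_sub_le_of_forall_ballMean hb (a := a) (l := l) hR] with x hx hxF
    obtain ⟨hxc, hxlt⟩ := hxF
    have hK : johnNirenbergStep d * M = l + 5 ^ d * M + 2 ^ d * M := by
      simp only [johnNirenbergStep, hl]
      ring
    have h5 : 0 < 5 ^ d * M := by positivity
    have hba := abs_sub_le (b x) a (ballMean μ b c R)
    rw [abs_sub_comm a] at hba
    have hxT : x ∈ T := by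
      refine ⟨hxc, ?_⟩
      by_contra! hno
      have := hx hno
      linarith
    obtain ⟨i, hiu, hsub⟩ := hcov x hxT
    have hiT := huT hiu
    refine Set.mem_iUnion₂.2 ⟨i, hiu, hsub (mem_closedBall_self (hr0 x hxT.1 hxT.2).le), ?_⟩
    have h6 := hr5 i hiT.1 hiT.2
    have h7 := abs_sub_le (b x) (ballMean μ b i (5 * r i)) a
    linarith
  have hmassi : ∀ i ∈ u, ENNReal.ofReal l * μ (closedBall i (r i)) ≤
      ∫⁻ y in closedBall i (r i), ENNReal.ofReal |b y - a| ∂μ := fun i hi => by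
    have hiT := huT hi
    refine le_trans ?_ (ofReal_abs_average_sub_mul_le
      (hb.integrableOn_isCompact (isCompact_closedBall i (r i))) measure_closedBall_lt_top.ne a)
    gcongr
    exact (hrl i hiT.1 hiT.2).le
  have hmass : ENNReal.ofReal l * ∑' i : u, μ (closedBall (i : E) (r i)) ≤
      ENNReal.ofReal (M * 2 ^ d) * μ (closedBall c R) := by
    rw [← ENNReal.tsum_mul_left]
    calc ∑' i : u, ENNReal.ofReal l * μ (closedBall (i : E) (r i))
        ≤ ∑' i : u, ∫⁻ y in closedBall (i : E) (r i), ENNReal.ofReal |b y - a| ∂μ :=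
          ENNReal.tsum_le_tsum fun i => hmassi i i.2
      _ = ∫⁻ y in ⋃ i ∈ u, closedBall i (r i), ENNReal.ofReal |b y - a| ∂μ :=
          (lintegral_biUnion hucount (fun i _ => measurableSet_closedBall) hdisj _).symm
      _ ≤ ∫⁻ y in closedBall c (2 * R), ENNReal.ofReal |b y - a| ∂μ := by
          refine lintegral_mono_set (Set.iUnion₂_subset fun i hi => ?_)
          have hiT := huT hi
          refine closedBall_subset_closedBall' ?_
          have := mem_closedBall.1 hiT.1
          have := hrR i hiT.1 hiT.2
          linarith
      _ ≤ ENNReal.ofReal M * μ (closedBall c (2 * R)) := h c _ (by positivity)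
      _ ≤ ENNReal.ofReal M * (ENNReal.ofReal (2 ^ d) * μ (closedBall c R)) := by
          gcongr
          exact measure_closedBall_le_of_le_mul c c hR (by positivity) (by norm_num) le_rfl
      _ = _ := by rw [ENNReal.ofReal_mul hM.le, mul_assoc]
  have hl' : ENNReal.ofReal l ≠ 0 := by simpa using hl0
  rw [← ENNReal.mul_le_mul_iff_right hl' ENNReal.ofReal_ne_top]
  calc ENNReal.ofReal l * μ {x ∈ closedBall c R |
          t + johnNirenbergStep d * M < |b x - ballMean μ b c R|}
      ≤ ENNReal.ofReal l * ∑' i : u,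
          μ {x ∈ closedBall (i : E) (5 * r i) | t < |b x - ballMean μ b i (5 * r i)|} := by
        gcongr
        exact (measure_mono_ae hcover).trans (measure_biUnion_le μ hucount _)
    _ ≤ ENNReal.ofReal l * ∑' i : u,
          θ * ENNReal.ofReal (5 ^ d) * μ (closedBall (i : E) (r i)) := by
        gcongr with i
        have hiT := huT i.2
        have hri := hr0 i hiT.1 hiT.2
        refine (hθ i _ (by positivity)).trans ?_
        rw [mul_assoc]
        gcongr
        exact measure_closedBall_le_of_le_mul _ _ hri (by positivity) (by norm_num) le_rfl
    _ = θ * ENNReal.ofReal (5 ^ d) *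
          (ENNReal.ofReal l * ∑' i : u, μ (closedBall (i : E) (r i))) := by
        rw [ENNReal.tsum_mul_left]
        ring
    _ ≤ θ * ENNReal.ofReal (5 ^ d) * (ENNReal.ofReal (M * 2 ^ d) * μ (closedBall c R)) := by
        gcongr
    _ = θ * ENNReal.ofReal (5 ^ d * (M * 2 ^ d)) * μ (closedBall c R) := by
        rw [ENNReal.ofReal_mul (p := 5 ^ d) (by positivity)]
        ring
    _ = ENNReal.ofReal l * (θ * 2⁻¹ * μ (closedBall c R)) := by
        have : l * 2⁻¹ = 5 ^ d * (M * 2 ^ d) := by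
          rw [hl, show (10 : ℝ) = 5 * 2 by norm_num, mul_pow]
          ring
        rw [← this, ENNReal.ofReal_mul hl0.le, ENNReal.ofReal_inv_of_pos (by norm_num)]
        simp only [ENNReal.ofReal_ofNat]
        ring

/-- **John–Nirenberg inequality**, in discrete form. -/
theorem MeanOscillationLE.measure_lt_abs_sub_le {b : E → ℝ} {M : ℝ}
    (h : MeanOscillationLE μ b M) (hb : LocallyIntegrable b μ) (hM : 0 < M) (k : ℕ) :
    ∀ (c : E) (r : ℝ), 0 < r →
      μ {x ∈ closedBall c r | k * (johnNirenbergStep (finrank ℝ E) * M) <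
        |b x - ballMean μ b c r|} ≤ 2⁻¹ ^ k * μ (closedBall c r) := by
  have hK := johnNirenbergStep_pos (finrank ℝ E)
  induction k with
  | zero =>
    intro c r _
    rw [pow_zero, one_mul]
    exact measure_mono fun _ hx => hx.1
  | succ k ih =>
    intro c r hr
    have := h.measure_lt_abs_sub_step hb hM (by positivity) ih c hr
    rw [pow_succ]
    rwa [show ((k + 1 : ℕ) : ℝ) * (johnNirenbergStep (finrank ℝ E) * M) =
      k * (johnNirenbergStep (finrank ℝ E) * M) + johnNirenbergStep (finrank ℝ E) * M by
        push_cast; ring]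

theorem summable_rpow_mul_half_pow (q : ℝ) :
    Summable fun k : ℕ => ((k : ℝ) + 1) ^ q * (1 / 2 : ℝ) ^ k := by
  have h1 := (summable_pow_mul_geometric_of_norm_lt_one (R := ℝ) ⌈q⌉₊ (r := 1 / 2)
    (by norm_num))
  have h2 := ((summable_nat_add_iff 1).2 h1).mul_left 2
  refine Summable.of_nonneg_of_le (fun k => by positivity) (fun k => ?_) h2
  have : ((k : ℝ) + 1) ^ q ≤ ((k : ℝ) + 1) ^ ⌈q⌉₊ := by
    rw [← Real.rpow_natCast]
    exact Real.rpow_le_rpow_of_exponent_le (by linarith [k.cast_nonneg (α := ℝ)]) (Nat.le_ceil q)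
  push_cast
  rw [pow_succ]
  calc _ ≤ ((k : ℝ) + 1) ^ ⌈q⌉₊ * (1 / 2 : ℝ) ^ k := by gcongr
    _ = _ := by ring

/-- Functions of bounded mean oscillation have bounded `q`-mean oscillation. -/
theorem MeanOscillationLE.lintegral_rpow_le {b : E → ℝ} {M : ℝ}
    (h : MeanOscillationLE μ b M) (hb : LocallyIntegrable b μ) (hM : 0 < M) {q : ℝ} (hq : 0 < q)
    (c : E) {r : ℝ} (hr : 0 < r) :
    ∫⁻ y in closedBall c r, ENNReal.ofReal (|b y - ballMean μ b c r| ^ q) ∂μ ≤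
      ENNReal.ofReal ((johnNirenbergStep (finrank ℝ E) * M) ^ q *
        ∑' k : ℕ, ((k : ℝ) + 1) ^ q * (1 / 2 : ℝ) ^ k) * μ (closedBall c r) := by
  set K := johnNirenbergStep (finrank ℝ E) * M with hKdef
  have hK : 0 < K := mul_pos (johnNirenbergStep_pos _) hM
  set ν := μ.restrict (closedBall c r) with hν
  set g : E → ℝ := fun y => |b y - ballMean μ b c r| with hg
  have hgm : AEMeasurable g ν :=
    ((hb.integrableOn_isCompact (isCompact_closedBall c r)).aemeasurable.sub_const _).abs
  have hnull : ∀ k : ℕ, NullMeasurableSet {y | (k : ℝ) * K < g y} ν := fun k =>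
    nullMeasurableSet_lt aemeasurable_const hgm
  have hpt : ∀ y, ENNReal.ofReal (g y ^ q) ≤
      ∑' k : ℕ, {y | (k : ℝ) * K < g y}.indicator
        (fun _ => ENNReal.ofReal ((((k : ℝ) + 1) * K) ^ q)) y := by
    intro y
    rcases (abs_nonneg (b y - ballMean μ b c r)).eq_or_lt with h0 | h0
    · simp [hg, ← h0, Real.zero_rpow hq.ne']
    · have hgy : 0 < g y := h0
      have hc : 0 < ⌈g y / K⌉₊ := Nat.ceil_pos.2 (by positivity)
      obtain ⟨k, hk⟩ := Nat.exists_eq_succ_of_ne_zero hc.ne'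
      have h1 : (k : ℝ) * K < g y := by
        rw [← lt_div_iff₀ hK]
        exact Nat.lt_ceil.1 (by omega)
      have h2 : g y ≤ ((k : ℝ) + 1) * K := by
        rw [← div_le_iff₀ hK]
        have := Nat.le_ceil (g y / K)
        rw [hk] at this
        exact_mod_cast this
      refine le_trans ?_ (ENNReal.le_tsum k)
      rw [Set.indicator_of_mem (show y ∈ {y | (k : ℝ) * K < g y} from h1)]
      gcongr
  have hsum := summable_rpow_mul_half_pow q
  calc ∫⁻ y, ENNReal.ofReal (g y ^ q) ∂ν
      ≤ ∫⁻ y, ∑' k : ℕ, {y | (k : ℝ) * K < g y}.indicator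
        (fun _ => ENNReal.ofReal ((((k : ℝ) + 1) * K) ^ q)) y ∂ν := lintegral_mono hpt
    _ = ∑' k : ℕ, ENNReal.ofReal ((((k : ℝ) + 1) * K) ^ q) * ν {y | (k : ℝ) * K < g y} := by
        rw [lintegral_tsum fun k => aemeasurable_const.indicator₀ (hnull k)]
        exact tsum_congr fun k => lintegral_indicator_const₀ (hnull k) _
    _ ≤ ∑' k : ℕ, ENNReal.ofReal (K ^ q) *
          ENNReal.ofReal (((k : ℝ) + 1) ^ q * (1 / 2 : ℝ) ^ k) * μ (closedBall c r) := by
        refine ENNReal.tsum_le_tsum fun k => ?_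
        have hk := h.measure_lt_abs_sub_le hb hM k c r hr
        have : ν {y | (k : ℝ) * K < g y} ≤ 2⁻¹ ^ k * μ (closedBall c r) := by
          rw [hν, Measure.restrict_apply₀ (hnull k), Set.inter_comm]
          exact hk
        refine (mul_le_mul_right this _).trans (le_of_eq ?_)
        have h2 : (2⁻¹ : ENNReal) ^ k = ENNReal.ofReal ((1 / 2 : ℝ) ^ k) := by
          rw [ENNReal.ofReal_pow (by norm_num), one_div, ENNReal.ofReal_inv_of_pos (by norm_num)]
          simp
        rw [h2, ← mul_assoc, ← ENNReal.ofReal_mul (by positivity),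
          ← ENNReal.ofReal_mul (by positivity), Real.mul_rpow (by positivity) hK.le]
        congr 2
        ring
    _ = _ := by
        rw [ENNReal.tsum_mul_right, ENNReal.tsum_mul_left,
          ← ENNReal.ofReal_tsum_of_nonneg (fun k => by positivity) hsum,
          ← ENNReal.ofReal_mul (by positivity)]

end JohnNirenberg

/-- The function `‖x‖ ^ (-β)`, cut off outside the unit ball. -/
noncomputable def truncatedPower (E : Type*) [NormedAddCommGroup E] (β : ℝ) : E → ℝ :=
  (ball (0 : E) 1).indicator fun x => ‖x‖ ^ (-β)

theorem abs_truncatedPower_rpow {E : Type*} [NormedAddCommGroup E] {β q : ℝ}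
    (hq : 0 < q) (x : E) :
    |truncatedPower E β x| ^ q = truncatedPower E (β * q) x := by
  by_cases hx : x ∈ ball (0 : E) 1
  · simp only [truncatedPower, Set.indicator_of_mem hx]
    rw [abs_of_nonneg (by positivity), ← Real.rpow_mul (norm_nonneg _), neg_mul]
  · simp [truncatedPower, Set.indicator_of_notMem hx, Real.zero_rpow hq.ne']

section CentralOscillation

variable {E : Type*} [NormedAddCommGroup E] [NormedSpace ℝ E] [FiniteDimensional ℝ E]
  [MeasurableSpace E] [BorelSpace E] {μ : Measure E} [μ.IsAddHaarMeasure]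

theorem ballMean_eq_setAverage_ball (b : E → ℝ) (c : E) {r : ℝ} (hr : 0 < r) :
    ballMean μ b c r = ⨍ z in ball c r, b z ∂μ :=
  setAverage_congr (closedBall_ae_eq_ball_of_pos c hr)

theorem meanOscillationLE_of_ball {b : E → ℝ} {M : ℝ}
    (h : ∀ (c : E) (r : ℝ), 0 < r →
      ∫⁻ y in ball c r, ENNReal.ofReal |b y - ⨍ z in ball c r, b z ∂μ| ∂μ ≤
        ENNReal.ofReal M * μ (ball c r)) : MeanOscillationLE μ b M := by
  intro c r hr
  rw [setLIntegral_congr (closedBall_ae_eq_ball_of_pos c hr),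
    measure_congr (closedBall_ae_eq_ball_of_pos c hr), ballMean_eq_setAverage_ball b c hr]
  exact h c r hr

/-- A function that vanishes on the unit ball and is both integrable and `q`-integrable has
bounded central `q`-mean oscillation. -/
theorem exists_central_oscillation_le {b : E → ℝ} {q : ℝ} (hq : 1 ≤ q) (hb : Integrable b μ)
    (hbq : Integrable (fun x => |b x| ^ q) μ) (h0 : ∀ x ∈ ball (0 : E) 1, b x = 0) :
    ∃ M : ℝ, ∀ r : ℝ, 0 < r →
      ∫⁻ y in ball (0 : E) r, ENNReal.ofReal (|b y - ⨍ z in ball (0 : E) r, b z ∂μ| ^ q) ∂μ ≤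
        ENNReal.ofReal (M ^ q) * μ (ball 0 r) := by
  have hq0 : 0 < q := by linarith
  have hfin : ∀ r : ℝ, μ (ball (0 : E) r) ≠ ⊤ := fun r => measure_ball_lt_top.ne
  set V := μ.real (ball (0 : E) 1) with hV
  have hVpos : 0 < V := ENNReal.toReal_pos (measure_ball_pos μ 0 one_pos).ne' (hfin 1)
  set A := ∫ x, |b x| ∂μ with hA
  set I := ∫ x, |b x| ^ q ∂μ with hI
  have hA0 : 0 ≤ A := integral_nonneg fun _ => abs_nonneg _
  have hI0 : 0 ≤ I := integral_nonneg fun _ => by positivity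
  set D := 2 ^ (q - 1) * (I / V + (A / V) ^ q) with hD
  have hD0 : 0 ≤ D := by positivity
  refine ⟨D ^ q⁻¹, fun r hr => ?_⟩
  rw [Real.rpow_inv_rpow hD0 hq0.ne']
  rcases le_or_gt r 1 with hr1 | hr1
  · have hz : ∀ x ∈ ball (0 : E) r, b x = 0 := fun x hx => h0 x (ball_subset_ball hr1 hx)
    have hm : ⨍ z in ball (0 : E) r, b z ∂μ = 0 := by
      rw [setAverage_eq, setIntegral_congr_fun measurableSet_ball hz]
      simp
    rw [setLIntegral_congr_fun (g := fun _ => 0) measurableSet_ball fun x hx => by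
      simp [hm, hz x hx, Real.zero_rpow hq0.ne']]
    simp
  · set m := ⨍ z in ball (0 : E) r, b z ∂μ with hm
    have hVr : V ≤ μ.real (ball (0 : E) r) :=
      measureReal_mono (ball_subset_ball hr1.le) (hfin r)
    have hmA : |m| ≤ A / V := by
      rw [hm, setAverage_eq, smul_eq_mul, abs_mul, abs_of_nonneg (by positivity), div_eq_inv_mul]
      gcongr
      exact (abs_integral_le_integral_abs).trans
        (setIntegral_le_integral hb.abs (Eventually.of_forall fun _ => abs_nonneg _))
    have hpt : ∀ y, |b y - m| ^ q ≤ 2 ^ (q - 1) * (|b y| ^ q + (A / V) ^ q) := fun y => calc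
      |b y - m| ^ q ≤ (|b y| + A / V) ^ q := by
        gcongr
        exact (abs_sub _ _).trans (by gcongr)
      _ ≤ _ := mod_cast NNReal.rpow_add_le_mul_rpow_add_rpow ⟨|b y|, abs_nonneg _⟩
        ⟨A / V, by positivity⟩ hq
    have hint : IntegrableOn (fun y => 2 ^ (q - 1) * (|b y| ^ q + (A / V) ^ q))
        (ball (0 : E) r) μ :=
      (hbq.integrableOn.add (integrableOn_const (hfin r))).const_mul _
    calc ∫⁻ y in ball (0 : E) r, ENNReal.ofReal (|b y - m| ^ q) ∂μ
        ≤ ∫⁻ y in ball (0 : E) r,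
            ENNReal.ofReal (2 ^ (q - 1) * (|b y| ^ q + (A / V) ^ q)) ∂μ :=
          lintegral_mono fun y => ENNReal.ofReal_le_ofReal (hpt y)
      _ = ENNReal.ofReal (∫ y in ball (0 : E) r, 2 ^ (q - 1) * (|b y| ^ q + (A / V) ^ q) ∂μ) :=
          (ofReal_integral_eq_lintegral_ofReal hint
            (Eventually.of_forall fun _ => by positivity)).symm
      _ ≤ ENNReal.ofReal (D * μ.real (ball (0 : E) r)) := by
          gcongr
          rw [integral_const_mul, integral_add hbq.integrableOn (integrableOn_const (hfin r)),
            setIntegral_const, smul_eq_mul, hD, mul_assoc, add_mul, mul_comm (μ.real _)]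
          gcongr
          calc ∫ y in ball (0 : E) r, |b y| ^ q ∂μ ≤ I :=
                setIntegral_le_integral hbq (Eventually.of_forall fun _ => by positivity)
            _ = I / V * V := by field_simp
            _ ≤ _ := by gcongr
      _ = ENNReal.ofReal D * μ (ball 0 r) := by
          rw [ENNReal.ofReal_mul hD0, measureReal_def, ENNReal.ofReal_toReal (hfin r)]

theorem integrable_truncatedPower {β : ℝ} (hd : 0 < finrank ℝ E) (hβ : β < finrank ℝ E) :
    Integrable (truncatedPower E β) μ := by
  refine (integrable_indicator_iff measurableSet_ball).2 ?_
  refine integrableOn_ball_of_norm_le_rpow (C := 1) hd hβ (Eventually.of_forall fun x => ?_)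
    (Measurable.aestronglyMeasurable (by fun_prop))
  rw [one_mul, Real.norm_of_nonneg (by positivity)]

theorem not_meanOscillationLE_truncatedPower {β M : ℝ} (hβ : 0 < β) (hd : 0 < finrank ℝ E)
    (hβd : β < finrank ℝ E) (e : E) (hM : 0 ≤ M) :
    ¬ MeanOscillationLE μ (fun x => truncatedPower E β (x - e)) M := by
  intro h
  have : Nontrivial E := Module.nontrivial_of_finrank_pos hd
  set b : E → ℝ := fun x => truncatedPower E β (x - e) with hb
  have hbint : Integrable b μ := (integrable_truncatedPower hd hβd).comp_sub_right e
  let m : ℕ → ℝ := fun k => ballMean μ b e ((1 / 2) ^ (k + 1))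
  have hstep : ∀ k, m (k + 1) ≤ m k + 2 ^ finrank ℝ E * M := fun k => by
    have := h.abs_ballMean_sub_le hbint.locallyIntegrable hM (x := e) (y := e)
      (r := (1 / 2) ^ (k + 1 + 1)) (s := (1 / 2) ^ (k + 1)) (κ := 2) (by positivity)
      (by positivity) (by norm_num)
      (closedBall_subset_closedBall (pow_le_pow_of_le_one (by norm_num) (by norm_num) (by omega)))
      (by rw [pow_succ _ (k + 1)]; linarith)
    have := (abs_le.1 this).2
    simp only [m]
    linarith
  have hupper : ∀ k : ℕ, m k ≤ m 0 + k * (2 ^ finrank ℝ E * M) := fun k => by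
    induction k with
    | zero => simp
    | succ k ih =>
      have := hstep k
      push_cast
      linarith
  have hlower : ∀ k : ℕ, ((2 : ℝ) ^ β) ^ k ≤ m k := fun k => by
    set r : ℝ := (1 / 2) ^ (k + 1) with hr
    have hr0 : 0 < r := by positivity
    have hr1 : r < 1 := pow_lt_one₀ (by norm_num) (by norm_num) (by omega)
    have hpos : 0 < μ.real (closedBall e r) :=
      ENNReal.toReal_pos (measure_closedBall_pos μ e hr0).ne' measure_closedBall_lt_top.ne
    have hae : ∀ᵐ x ∂μ, x ∈ closedBall e r → ((2 : ℝ) ^ β) ^ k ≤ b x := by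
      filter_upwards [compl_mem_ae_iff.2 (measure_singleton (μ := μ) e)] with x hxe hx
      have hx' : ‖x - e‖ ≤ r := by rwa [← dist_eq_norm]
      have hx0 : 0 < ‖x - e‖ := norm_pos_iff.2 (sub_ne_zero.2 hxe)
      have hmem : x - e ∈ ball (0 : E) 1 := by
        rw [mem_ball_zero_iff]
        linarith
      simp only [hb, truncatedPower, Set.indicator_of_mem hmem]
      calc ((2 : ℝ) ^ β) ^ k = ((1 / 2 : ℝ) ^ k) ^ (-β) := by
            rw [← Real.rpow_natCast, ← Real.rpow_natCast, ← Real.rpow_mul (by norm_num),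
              ← Real.rpow_mul (by norm_num), one_div, Real.inv_rpow (by norm_num),
              ← Real.rpow_neg (by norm_num)]
            ring_nf
        _ ≤ ‖x - e‖ ^ (-β) := by
            refine Real.rpow_le_rpow_of_nonpos hx0 (hx'.trans ?_) (by linarith)
            exact pow_le_pow_of_le_one (by norm_num) (by norm_num) (by omega)
    have hmono : ((2 : ℝ) ^ β) ^ k * μ.real (closedBall e r) ≤ ∫ x in closedBall e r, b x ∂μ := by
      have := setIntegral_mono_on_ae (integrableOn_const measure_closedBall_lt_top.ne)
        hbint.integrableOn measurableSet_closedBall hae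
      rwa [setIntegral_const, smul_eq_mul, mul_comm] at this
    change _ ≤ ⨍ z in closedBall e r, b z ∂μ
    rw [setAverage_eq, smul_eq_mul, ← div_eq_inv_mul, le_div_iff₀ hpos]
    exact hmono
  have hgt : 1 < (2 : ℝ) ^ β := Real.one_lt_rpow (by norm_num) hβ
  have hlim : Tendsto (fun k : ℕ => (m 0 + k * (2 ^ finrank ℝ E * M)) / ((2 : ℝ) ^ β) ^ k) atTop
      (𝓝 0) := by
    have h1 := (tendsto_pow_const_div_const_pow_of_one_lt 1 hgt).mul_const (2 ^ finrank ℝ E * M)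
    have h0 := (tendsto_pow_const_div_const_pow_of_one_lt 0 hgt).mul_const (m 0)
    have := h0.add h1
    simp only [zero_mul, add_zero] at this
    refine this.congr fun k => ?_
    ring
  refine absurd (ge_of_tendsto hlim (Eventually.of_forall fun k => ?_)) (not_le.2 one_pos)
  rw [le_div_iff₀ (by positivity), one_mul]
  exact (hlower k).trans (hupper k)

end CentralOscillation

/-- `BMO(ℝⁿ) ⊊ CBMO^q(ℝⁿ)` for `1 ≤ q < ∞`: every `b ∈ BMO` satisfies
`‖b‖_{CBMO^q} ≤ C‖b‖_{BMO}` (via John–Nirenberg for `q > 1`), but there is a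
`b ∈ CBMO^q` which is not in `BMO`. -/
theorem bmo_properly_contained_in_cbmo (n : ℕ) (hn : 0 < n) (q : ℝ) (hq : 1 ≤ q) :
    (∃ C : ℝ, 0 < C ∧ ∀ (b : EuclideanSpace ℝ (Fin n) → ℝ),
      LocallyIntegrable b volume → ∀ M : ℝ, 0 ≤ M →
      (∀ (c : EuclideanSpace ℝ (Fin n)) (ρ : ℝ), 0 < ρ →
        (∫⁻ y in ball c ρ, ENNReal.ofReal |b y - ⨍ z in ball c ρ, b z|) ≤
          ENNReal.ofReal M * volume (ball c ρ)) →
      ∀ ρ : ℝ, 0 < ρ →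
        (∫⁻ y in ball (0 : EuclideanSpace ℝ (Fin n)) ρ,
            ENNReal.ofReal (|b y - ⨍ z in ball (0 : EuclideanSpace ℝ (Fin n)) ρ, b z| ^ q)) ≤
          ENNReal.ofReal ((C * M) ^ q) * volume (ball (0 : EuclideanSpace ℝ (Fin n)) ρ)) ∧
    (∃ b : EuclideanSpace ℝ (Fin n) → ℝ, LocallyIntegrable b volume ∧
      (∃ M : ℝ, ∀ ρ : ℝ, 0 < ρ →
        (∫⁻ y in ball (0 : EuclideanSpace ℝ (Fin n)) ρ,
            ENNReal.ofReal (|b y - ⨍ z in ball (0 : EuclideanSpace ℝ (Fin n)) ρ, b z| ^ q)) ≤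
          ENNReal.ofReal (M ^ q) * volume (ball (0 : EuclideanSpace ℝ (Fin n)) ρ)) ∧
      ¬ (∃ M : ℝ, ∀ (c : EuclideanSpace ℝ (Fin n)) (ρ : ℝ), 0 < ρ →
        (∫⁻ y in ball c ρ, ENNReal.ofReal |b y - ⨍ z in ball c ρ, b z|) ≤
          ENNReal.ofReal M * volume (ball c ρ))) := by
  have hdim : finrank ℝ (EuclideanSpace ℝ (Fin n)) = n := finrank_euclideanSpace_fin
  have hq0 : 0 < q := by linarith
  refine ⟨?_, ?_⟩
  · set S : ℝ := ∑' k : ℕ, ((k : ℝ) + 1) ^ q * (1 / 2 : ℝ) ^ k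
    have hS : 0 ≤ S := tsum_nonneg fun k => by positivity
    have hK := johnNirenbergStep_pos n
    refine ⟨johnNirenbergStep n * (S + 1) ^ q⁻¹, by positivity, ?_⟩
    intro b hb M hM h ρ hρ
    rcases hM.eq_or_lt with rfl | hM
    · have hbρ : IntegrableOn b (ball 0 ρ) :=
        (hb.integrableOn_isCompact (isCompact_closedBall _ ρ)).mono_set ball_subset_closedBall
      have h0 := h 0 ρ hρ
      rw [ENNReal.ofReal_zero, zero_mul, nonpos_iff_eq_zero, lintegral_eq_zero_iff'
        (hbρ.aestronglyMeasurable.aemeasurable.sub_const _).abs.ennreal_ofReal] at h0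
      rw [lintegral_congr_ae (g := fun _ => 0)]
      · simp
      · filter_upwards [h0] with y hy
        have hy' : |b y - ⨍ z in ball (0 : EuclideanSpace ℝ (Fin n)) ρ, b z| = 0 :=
          le_antisymm (ENNReal.ofReal_eq_zero.1 hy) (abs_nonneg _)
        simp [hy', Real.zero_rpow hq0.ne']
    · have key := (meanOscillationLE_of_ball h).lintegral_rpow_le hb hM hq0 0 hρ
      rw [setLIntegral_congr (closedBall_ae_eq_ball_of_pos 0 hρ),
        measure_congr (closedBall_ae_eq_ball_of_pos 0 hρ), ballMean_eq_setAverage_ball b 0 hρ,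
        hdim] at key
      refine key.trans ?_
      gcongr
      calc (johnNirenbergStep n * M) ^ q * S ≤ (johnNirenbergStep n * M) ^ q * (S + 1) := by
            gcongr
            linarith
        _ = (johnNirenbergStep n * (S + 1) ^ q⁻¹ * M) ^ q := by
            rw [mul_right_comm, Real.mul_rpow (x := johnNirenbergStep n * M) (by positivity)
              (by positivity), Real.rpow_inv_rpow (by positivity) hq0.ne']
  · have hn' : (0 : ℝ) < n := by exact_mod_cast hn
    have hd : 0 < finrank ℝ (EuclideanSpace ℝ (Fin n)) := by rwa [hdim]
    set β : ℝ := n / 2 / q with hβ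
    have hβ0 : 0 < β := by positivity
    have hβq : β * q < finrank ℝ (EuclideanSpace ℝ (Fin n)) := by
      rw [hdim, hβ, div_mul_cancel₀ _ hq0.ne']
      linarith
    have hβd : β < finrank ℝ (EuclideanSpace ℝ (Fin n)) :=
      (le_mul_of_one_le_right hβ0.le hq).trans_lt hβq
    set e : EuclideanSpace ℝ (Fin n) := EuclideanSpace.single ⟨0, hn⟩ 2 with he
    have hint : Integrable (fun x : EuclideanSpace ℝ (Fin n) =>
        truncatedPower (EuclideanSpace ℝ (Fin n)) β (x - e)) :=
      (integrable_truncatedPower hd hβd).comp_sub_right e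
    refine ⟨fun x => truncatedPower (EuclideanSpace ℝ (Fin n)) β (x - e), hint.locallyIntegrable,
      exists_central_oscillation_le hq hint ?_ ?_, ?_⟩
    · simp only [abs_truncatedPower_rpow hq0]
      exact (integrable_truncatedPower hd hβq).comp_sub_right e
    · intro x hx
      refine Set.indicator_of_notMem ?_ _
      have hnorm : ‖e‖ = 2 := by rw [he, PiLp.norm_single, Real.norm_ofNat]
      have h1 := norm_sub_norm_le e x
      rw [mem_ball_zero_iff] at hx ⊢
      rw [norm_sub_rev]
      linarith
    · rintro ⟨M, hM⟩
      refine not_meanOscillationLE_truncatedPower (μ := volume) hβ0 hd hβd e (le_max_right M 0)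
        (meanOscillationLE_of_ball fun c r hr => (hM c r hr).trans ?_)
      gcongr
      exact le_max_left M 0
end
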